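/- arXiv:2102.06782 — 5 statements merged into one kernel-verified Lean document; each statement's English description precedes it below -/
import Mathlib

section
/- Let S and A be types, D a finite set of state–action pairs in S × A satisfying the state-determines-action assumption, and ξ : S × A → ℝ with ξ(s,a) > 0 for every (s,a) ∈ D. If a policy π : S → PMF A satisfies π s a > 0 for every (s,a) ∈ D and ∑_{(s,a) ∈ D} ξ(s,a) · Real.log (π s a) = 0, then π s a = 1 for every (s,a) ∈ D; that is, the maximum of the AWR objective is attained only by policies that assign probability 1 to the action recorded in the replay buffer at every state appearing in the buffer. -/
/-- **Uniqueness of the AWR maximizer (discrete actions).**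
If a policy `π` has positive probability on every buffer pair and its AWR objective
`∑_{(s,a) ∈ D} ξ(s,a) · log (π s a)` equals the maximum value `0`, then `π` assigns
probability `1` to the recorded action at every state appearing in the buffer. -/
theorem awr_maximizer_unique_discrete
    {S A : Type*} (D : Finset (S × A))
    (hSDA : ∀ p ∈ D, ∀ q ∈ D, p.1 = q.1 → p.2 = q.2)
    (ξ : S × A → ℝ) (hξ : ∀ p ∈ D, 0 < ξ p)
    (π : S → PMF A) (hπpos : ∀ p ∈ D, 0 < π p.1 p.2)
    (hmax : ∑ p ∈ D, ξ p * Real.log ((π p.1 p.2).toReal) = 0) :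
    ∀ p ∈ D, π p.1 p.2 = 1 := by
  have hle : ∀ p ∈ D, (π p.1 p.2).toReal ≤ 1 := fun p _ =>
    ENNReal.toReal_le_of_le_ofReal zero_le_one (by simpa using (π p.1).coe_le_one p.2)
  have hpos : ∀ p ∈ D, 0 < (π p.1 p.2).toReal := fun p hp =>
    ENNReal.toReal_pos (hπpos p hp).ne' ((π p.1).apply_ne_top p.2)
  have hterm : ∀ p ∈ D, ξ p * Real.log ((π p.1 p.2).toReal) ≤ 0 := fun p hp =>
    mul_nonpos_of_nonneg_of_nonpos (hξ p hp).le
      (Real.log_nonpos (hpos p hp).le (hle p hp))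
  intro p hp
  have hlog : Real.log ((π p.1 p.2).toReal) = 0 :=
    (mul_eq_zero.mp ((Finset.sum_eq_zero_iff_of_nonpos hterm).mp hmax p hp)).resolve_left
      (hξ p hp).ne'
  exact (ENNReal.toReal_eq_one_iff _).mp (Real.eq_one_of_pos_of_log_eq_zero (hpos p hp) hlog)
end

section
/- Let S be a type and let actions be real numbers. Let D be a finite set of pairs in S × ℝ satisfying the state-determines-action assumption, let ξ : S × ℝ → ℝ satisfy ξ(s,a) > 0 for every (s,a) ∈ D, and let ε > 0. For all functions m : S → ℝ and v : S → ℝ with v(s) ≥ ε for every s, the Gaussian AWR objective ∑_{(s,a) ∈ D} ξ(s,a) · ( −Real.log (v(s) · √(2π)) − (a − m(s))² / (2 · v(s)²) ) is at most ∑_{(s,a) ∈ D} ξ(s,a) · ( −Real.log (ε · √(2π)) ), with equality if and only if m(s) = a and v(s) = ε for every (s,a) ∈ D. In particular, the objective over the family of Gaussian policies with per-state mean m(s) and per-state standard deviation v(s) ≥ ε is maximized exactly when the mean at each buffer state equals the recorded action and the standard deviation equals the minimal allowed value ε. -/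
/-- The Gaussian log-density with standard deviation `σ ≥ ε` is at most the density's peak value
at standard deviation `ε`. -/
theorem gaussian_log_density_le {ε σ : ℝ} (hε : 0 < ε) (hσ : ε ≤ σ) (μ a : ℝ) :
    -Real.log (σ * Real.sqrt (2 * Real.pi)) - (a - μ) ^ 2 / (2 * σ ^ 2)
      ≤ -Real.log (ε * Real.sqrt (2 * Real.pi)) := by
  have hlog : Real.log (ε * Real.sqrt (2 * Real.pi)) ≤ Real.log (σ * Real.sqrt (2 * Real.pi)) :=
    Real.log_le_log (by positivity) (by gcongr)
  have hquad : 0 ≤ (a - μ) ^ 2 / (2 * σ ^ 2) := by positivity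
  linarith

/-- The bound `gaussian_log_density_le` is attained only at the mean, with minimal standard
deviation. -/
theorem gaussian_log_density_eq_iff {ε σ : ℝ} (hε : 0 < ε) (hσ : ε ≤ σ) (μ a : ℝ) :
    -Real.log (σ * Real.sqrt (2 * Real.pi)) - (a - μ) ^ 2 / (2 * σ ^ 2)
      = -Real.log (ε * Real.sqrt (2 * Real.pi)) ↔ μ = a ∧ σ = ε := by
  have hσ0 : 0 < σ := hε.trans_le hσ
  constructor
  · intro h
    have hquad : 0 ≤ (a - μ) ^ 2 / (2 * σ ^ 2) := by positivity
    have hσε : σ = ε := by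
      refine (hσ.eq_or_lt.resolve_right fun hlt => ?_).symm
      have hlog : Real.log (ε * Real.sqrt (2 * Real.pi)) < Real.log (σ * Real.sqrt (2 * Real.pi)) :=
        Real.log_lt_log (by positivity) (by gcongr)
      linarith
    subst hσε
    have hzero : (a - μ) ^ 2 / (2 * σ ^ 2) = 0 := by linarith
    have hsq : (a - μ) ^ 2 = 0 := (div_eq_zero_iff.mp hzero).resolve_right (by positivity)
    exact ⟨(sub_eq_zero.mp (pow_eq_zero_iff two_ne_zero |>.mp hsq)).symm, rfl⟩
  · rintro ⟨rfl, rfl⟩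
    simp

/-- **AWR objective under state-determines-action (Gaussian policies).**
For a replay buffer `D ⊆ S × ℝ` satisfying state-determines-action, positive weights `ξ`,
and Gaussian policies with per-state mean `m s` and standard deviation `v s ≥ ε > 0`,
the AWR objective `∑_{(s,a) ∈ D} ξ(s,a) · (−log(v s · √(2π)) − (a − m s)²/(2 (v s)²))`
is at most `∑_{(s,a) ∈ D} ξ(s,a) · (−log(ε · √(2π)))`, with equality iff `m s = a` and
`v s = ε` at every buffer pair `(s,a)`. -/
theorem awr_clones_replay_buffer_gaussian
    {S : Type*} (D : Finset (S × ℝ))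
    (hSDA : ∀ p ∈ D, ∀ q ∈ D, p.1 = q.1 → p.2 = q.2)
    (ξ : S × ℝ → ℝ) (hξ : ∀ p ∈ D, 0 < ξ p)
    (ε : ℝ) (hε : 0 < ε)
    (m v : S → ℝ) (hv : ∀ s, ε ≤ v s) :
    (∑ p ∈ D, ξ p *
        (-Real.log (v p.1 * Real.sqrt (2 * Real.pi))
          - (p.2 - m p.1) ^ 2 / (2 * (v p.1) ^ 2))
      ≤ ∑ p ∈ D, ξ p * (-Real.log (ε * Real.sqrt (2 * Real.pi)))) ∧
    ((∑ p ∈ D, ξ p *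
        (-Real.log (v p.1 * Real.sqrt (2 * Real.pi))
          - (p.2 - m p.1) ^ 2 / (2 * (v p.1) ^ 2))
      = ∑ p ∈ D, ξ p * (-Real.log (ε * Real.sqrt (2 * Real.pi))))
      ↔ ∀ p ∈ D, m p.1 = p.2 ∧ v p.1 = ε) := by
  have hle : ∀ p ∈ D, ξ p *
      (-Real.log (v p.1 * Real.sqrt (2 * Real.pi)) - (p.2 - m p.1) ^ 2 / (2 * (v p.1) ^ 2))
      ≤ ξ p * (-Real.log (ε * Real.sqrt (2 * Real.pi))) := fun p hp =>
    mul_le_mul_of_nonneg_left (gaussian_log_density_le hε (hv p.1) _ _) (hξ p hp).le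
  refine ⟨Finset.sum_le_sum hle, (Finset.sum_eq_sum_iff_of_le hle).trans ?_⟩
  refine forall₂_congr fun p hp => ?_
  rw [mul_right_inj' (hξ p hp).ne', gaussian_log_density_eq_iff hε (hv p.1)]
end

section
/- Let A be a nonempty finite type, S a type, and D a finite set of states in S. Let μ : S → A → ℝ be a sampling policy (for each s, μ s is nonnegative and sums to 1 over A), let Q : S → A → ℝ, and let β > 0. Define V(s) = ∑_a μ s a · Q s a, the weights w(s,a) = exp((Q s a − V(s))/β), the normalizer Z(s) = ∑_a μ s a · w(s,a), and the target policy π*(s,a) = μ s a · w(s,a) / Z(s). Then: (i) Z(s) > 0 and for each s ∈ D, π*(s,·) is nonnegative and sums to 1 over A; (ii) for every policy π : S → A → ℝ (for each s, π s is nonnegative and sums to 1) satisfying π s a > 0 whenever s ∈ D and μ s a > 0, we have ∑_{s ∈ D} ∑_a μ s a · w(s,a) · Real.log (π s a) ≤ ∑_{s ∈ D} ∑_a μ s a · w(s,a) · Real.log (π*(s,a)); and (iii) equality holds if and only if π s a = π*(s,a) for every s ∈ D and every a with μ s a > 0. Hence the QWR actor update applied to a replay buffer of states D sampled by μ yields the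 expected-improvement-optimal policy π* restricted to D. -/
theorem mul_log_lt_mul_log_add_sub {p q : ℝ} (hp : 0 ≤ p) (hq : 0 ≤ q)
    (hpq : 0 < p → 0 < q) (hne : q ≠ p) :
    p * Real.log q < p * Real.log p + (q - p) := by
  rcases hp.eq_or_lt with rfl | hp
  · simpa using hq.lt_of_ne' hne
  · have hq := hpq hp
    have h := Real.log_lt_sub_one_of_pos (div_pos hq hp) (by rwa [ne_eq, div_eq_one_iff_eq hp.ne'])
    rw [Real.log_div hq.ne' hp.ne'] at h
    have h2 := mul_lt_mul_of_pos_left h hp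
    have h3 : p * (q / p - 1) = q - p := by field_simp
    linarith

theorem mul_log_le_mul_log_add_sub {p q : ℝ} (hp : 0 ≤ p) (hq : 0 ≤ q)
    (hpq : 0 < p → 0 < q) :
    p * Real.log q ≤ p * Real.log p + (q - p) := by
  by_cases hne : q = p
  · simp [hne]
  · exact (mul_log_lt_mul_log_add_sub hp hq hpq hne).le

/-- **Gibbs' inequality** on a finite type. -/
theorem sum_mul_log_le_sum_mul_log {A : Type*} [Fintype A] {p q : A → ℝ}
    (hp : ∀ a, 0 ≤ p a) (hq : ∀ a, 0 ≤ q a) (hpq : ∀ a, 0 < p a → 0 < q a)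
    (hsum : ∑ a, q a = ∑ a, p a) :
    ∑ a, p a * Real.log (q a) ≤ ∑ a, p a * Real.log (p a) := by
  have h := Finset.sum_le_sum fun a (_ : a ∈ Finset.univ) ↦
    mul_log_le_mul_log_add_sub (hp a) (hq a) (hpq a)
  simpa [Finset.sum_add_distrib, Finset.sum_sub_distrib, hsum] using h

/-- The equality case of Gibbs' inequality on a finite type. -/
theorem sum_mul_log_eq_sum_mul_log_iff {A : Type*} [Fintype A] {p q : A → ℝ}
    (hp : ∀ a, 0 ≤ p a) (hq : ∀ a, 0 ≤ q a) (hpq : ∀ a, 0 < p a → 0 < q a)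
    (hsum : ∑ a, q a = ∑ a, p a) :
    ∑ a, p a * Real.log (q a) = ∑ a, p a * Real.log (p a) ↔ ∀ a, 0 < p a → q a = p a := by
  constructor
  · intro h a _
    by_contra hne
    have hlt := Finset.sum_lt_sum
      (fun a (_ : a ∈ Finset.univ) ↦ mul_log_le_mul_log_add_sub (hp a) (hq a) (hpq a))
      ⟨a, Finset.mem_univ a, mul_log_lt_mul_log_add_sub (hp a) (hq a) (hpq a) hne⟩
    simp [Finset.sum_add_distrib, Finset.sum_sub_distrib, hsum, h] at hlt
  · refine fun h ↦ Finset.sum_congr rfl fun a _ ↦ ?_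
    rcases (hp a).eq_or_lt with h0 | h0
    · simp [← h0]
    · rw [h a h0]

/-- **QWR actor update recovers the expected-improvement-optimal policy on the buffer.**
Let `μ` be the sampling policy, `Q` its state-action value function, `β > 0`,
`V s = E_{a∼μ s} Q s a`, weights `w s a = exp((Q s a − V s)/β)`, normalizer
`Z s = ∑_a μ s a · w s a`, and target policy `π*(s,a) = μ s a · w s a / Z s`.
Then `Z s > 0` and `π*(s,·)` is a probability mass function on each buffer state;
every policy `π` positive where `μ` is positive on buffer states has QWR objective
at most that of `π*`; and equality holds iff `π` agrees with `π*` on the support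
of `μ` at every buffer state. -/
theorem qwr_actor_update_optimal
    {A : Type*} [Fintype A] [Nonempty A] {S : Type*}
    (D : Finset S)
    (μ : S → A → ℝ) (hμ0 : ∀ s a, 0 ≤ μ s a) (hμ1 : ∀ s, ∑ a, μ s a = 1)
    (Q : S → A → ℝ) (β : ℝ) (hβ : 0 < β)
    (V : S → ℝ) (hV : ∀ s, V s = ∑ a, μ s a * Q s a)
    (w : S → A → ℝ) (hw : ∀ s a, w s a = Real.exp ((Q s a - V s) / β))
    (Z : S → ℝ) (hZ : ∀ s, Z s = ∑ a, μ s a * w s a)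
    (πstar : S → A → ℝ) (hπstar : ∀ s a, πstar s a = μ s a * w s a / Z s) :
    (∀ s, 0 < Z s) ∧
    (∀ s ∈ D, (∀ a, 0 ≤ πstar s a) ∧ ∑ a, πstar s a = 1) ∧
    (∀ π : S → A → ℝ, (∀ s a, 0 ≤ π s a) → (∀ s, ∑ a, π s a = 1) →
      (∀ s ∈ D, ∀ a, 0 < μ s a → 0 < π s a) →
      (∑ s ∈ D, ∑ a, μ s a * w s a * Real.log (π s a)
        ≤ ∑ s ∈ D, ∑ a, μ s a * w s a * Real.log (πstar s a)) ∧
      ((∑ s ∈ D, ∑ a, μ s a * w s a * Real.log (π s a)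
        = ∑ s ∈ D, ∑ a, μ s a * w s a * Real.log (πstar s a))
        ↔ ∀ s ∈ D, ∀ a, 0 < μ s a → π s a = πstar s a)) := by
  have hwpos : ∀ s a, 0 < w s a := fun s a ↦ hw s a ▸ Real.exp_pos _
  have hZpos : ∀ s, 0 < Z s := fun s ↦ by
    rw [hZ]
    obtain ⟨a, ha, hane⟩ := Finset.exists_ne_zero_of_sum_ne_zero ((hμ1 s).trans_ne one_ne_zero)
    exact Finset.sum_pos' (fun a _ ↦ mul_nonneg (hμ0 s a) (hwpos s a).le)
      ⟨a, ha, mul_pos ((hμ0 s a).lt_of_ne' hane) (hwpos s a)⟩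
  have hstar0 : ∀ s a, 0 ≤ πstar s a := fun s a ↦ by
    rw [hπstar]
    exact div_nonneg (mul_nonneg (hμ0 s a) (hwpos s a).le) (hZpos s).le
  have hstar1 : ∀ s, ∑ a, πstar s a = 1 := fun s ↦ by
    simp_rw [hπstar, ← Finset.sum_div, ← hZ]
    exact div_self (hZpos s).ne'
  have hstar_pos : ∀ s a, 0 < πstar s a ↔ 0 < μ s a := fun s a ↦ by
    rw [hπstar, div_pos_iff_of_pos_right (hZpos s), mul_pos_iff_of_pos_right (hwpos s a)]
  refine ⟨hZpos, fun s _ ↦ ⟨hstar0 s, hstar1 s⟩, fun π hπ0 hπ1 hπpos ↦ ?_⟩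
  have hobj : ∀ (ρ : S → A → ℝ) s, ∑ a, μ s a * w s a * Real.log (ρ s a) =
      Z s * ∑ a, πstar s a * Real.log (ρ s a) := fun ρ s ↦ by
    rw [Finset.mul_sum]
    refine Finset.sum_congr rfl fun a _ ↦ ?_
    rw [hπstar s a, ← mul_assoc, mul_div_cancel₀ _ (hZpos s).ne']
  have hsupp : ∀ s ∈ D, ∀ a, 0 < πstar s a → 0 < π s a := fun s hs a ha ↦
    hπpos s hs a ((hstar_pos s a).1 ha)
  have hsum : ∀ s, ∑ a, π s a = ∑ a, πstar s a := fun s ↦ (hπ1 s).trans (hstar1 s).symm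
  simp_rw [hobj]
  have hle : ∀ s ∈ D, Z s * ∑ a, πstar s a * Real.log (π s a) ≤
      Z s * ∑ a, πstar s a * Real.log (πstar s a) := fun s hs ↦
    mul_le_mul_of_nonneg_left
      (sum_mul_log_le_sum_mul_log (hstar0 s) (hπ0 s) (hsupp s hs) (hsum s)) (hZpos s).le
  refine ⟨Finset.sum_le_sum hle, ?_⟩
  rw [Finset.sum_eq_sum_iff_of_le hle]
  refine forall₂_congr fun s hs ↦ ?_
  rw [mul_right_inj' (hZpos s).ne',
    sum_mul_log_eq_sum_mul_log_iff (hstar0 s) (hπ0 s) (hsupp s hs) (hsum s)]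
  simp_rw [hstar_pos]
end

section
/- Let n be a positive natural number and x : Fin n → ℝ. Then the function τ ↦ τ · Real.log ( (1/n) · ∑_i Real.exp (x i / τ) ) tends to max over i of x i as τ tends to 0 from the right (i.e., along the filter nhdsWithin 0 (Set.Ioi 0)). -/
theorem lse_le_of_forall_le {n : ℕ} (hn : 0 < n) {x : Fin n → ℝ} {M τ : ℝ} (hτ : 0 < τ)
    (hM : ∀ i, x i ≤ M) :
    τ * Real.log ((1 / (n : ℝ)) * ∑ i, Real.exp (x i / τ)) ≤ M := by
  have hn' : (0 : ℝ) < n := Nat.cast_pos.mpr hn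
  have : Nonempty (Fin n) := ⟨⟨0, hn⟩⟩
  have hpos : 0 < ∑ i, Real.exp (x i / τ) :=
    Finset.sum_pos (fun i _ => Real.exp_pos _) Finset.univ_nonempty
  rw [mul_comm, ← le_div_iff₀ hτ, Real.log_le_iff_le_exp (by positivity),
    one_div, inv_mul_le_iff₀ hn']
  calc ∑ i, Real.exp (x i / τ) ≤ ∑ _i : Fin n, Real.exp (M / τ) := by
        gcongr with i
        exact hM i
    _ = n * Real.exp (M / τ) := by simp

theorem sub_mul_log_card_le_lse {n : ℕ} (x : Fin n → ℝ) {τ : ℝ} (hτ : 0 < τ) (i : Fin n) :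
    x i - τ * Real.log n ≤ τ * Real.log ((1 / (n : ℝ)) * ∑ j, Real.exp (x j / τ)) := by
  have hn' : (0 : ℝ) < n := Nat.cast_pos.mpr i.pos
  have hle : Real.exp (x i / τ) ≤ ∑ j, Real.exp (x j / τ) :=
    Finset.single_le_sum (fun j _ => (Real.exp_pos (x j / τ)).le) (Finset.mem_univ i)
  calc x i - τ * Real.log n = τ * Real.log ((1 / (n : ℝ)) * Real.exp (x i / τ)) := by
        rw [Real.log_mul (by positivity) (Real.exp_ne_zero _), Real.log_exp, one_div,
          Real.log_inv]
        field_simp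
        ring
    _ ≤ _ := by gcongr

/-- **Low-temperature limit of the log-sum-exp backup is the max backup.**
As `τ → 0⁺`, `τ · log((1/n) ∑ᵢ exp(xᵢ/τ))` tends to `maxᵢ xᵢ`. -/
theorem lse_tendsto_max_at_zero_temperature
    (n : ℕ) (hn : 0 < n) (x : Fin n → ℝ) :
    Filter.Tendsto
      (fun τ : ℝ => τ * Real.log ((1 / (n : ℝ)) * ∑ i, Real.exp (x i / τ)))
      (nhdsWithin 0 (Set.Ioi 0))
      (nhds (Finset.univ.sup' ⟨⟨0, hn⟩, Finset.mem_univ _⟩ x)) := by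
  obtain ⟨i, -, hi⟩ := Finset.exists_mem_eq_sup' ⟨⟨0, hn⟩, Finset.mem_univ _⟩ x
  have hmax : ∀ j, x j ≤ x i := fun j => hi ▸ Finset.le_sup' x (Finset.mem_univ j)
  rw [hi]
  have hlower : Filter.Tendsto (fun τ : ℝ => x i - τ * Real.log n)
      (nhdsWithin 0 (Set.Ioi 0)) (nhds (x i)) := by
    have hcont : Continuous fun τ : ℝ => x i - τ * Real.log n := by fun_prop
    simpa using (hcont.tendsto 0).mono_left nhdsWithin_le_nhds
  refine tendsto_of_tendsto_of_tendsto_of_le_of_le' hlower tendsto_const_nhds ?_ ?_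
  · filter_upwards [self_mem_nhdsWithin] with τ hτ
    exact sub_mul_log_card_le_lse x hτ i
  · filter_upwards [self_mem_nhdsWithin] with τ hτ
    exact lse_le_of_forall_le hn hτ hmax
end

section
/- Let n be a positive natural number and x : Fin n → ℝ. Then the function τ ↦ τ · Real.log ( (1/n) · ∑_i Real.exp (x i / τ) ) tends to (1/n) · ∑_i x i as τ tends to +∞ (i.e., along the filter atTop). -/
theorem hasDerivAt_log_mean_exp_zero {n : ℕ} (hn : 0 < n) (x : Fin n → ℝ) :
    HasDerivAt (fun t : ℝ => Real.log ((1 / (n : ℝ)) * ∑ i, Real.exp (x i * t)))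
      ((1 / (n : ℝ)) * ∑ i, x i) 0 := by
  have hn' : (n : ℝ) ≠ 0 := by positivity
  have hsum : HasDerivAt (fun t : ℝ => ∑ i, Real.exp (x i * t)) (∑ i, x i) 0 := by
    refine HasDerivAt.fun_sum fun i _ => ?_
    simpa using ((hasDerivAt_id (0 : ℝ)).const_mul (x i)).exp
  simpa [hn'] using (hsum.const_mul (1 / (n : ℝ))).log (by simp [hn'])

/-- **High-temperature limit of the log-sum-exp backup is the average backup.**
As `τ → +∞`, `τ · log((1/n) ∑ᵢ exp(xᵢ/τ))` tends to `(1/n) ∑ᵢ xᵢ`. -/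
theorem lse_tendsto_mean_at_high_temperature
    (n : ℕ) (hn : 0 < n) (x : Fin n → ℝ) :
    Filter.Tendsto
      (fun τ : ℝ => τ * Real.log ((1 / (n : ℝ)) * ∑ i, Real.exp (x i / τ)))
      Filter.atTop
      (nhds ((1 / (n : ℝ)) * ∑ i, x i)) := by
  have hn' : (n : ℝ) ≠ 0 := by positivity
  have h := (hasDerivAt_log_mean_exp_zero hn x).tendsto_slope_zero_right.comp
    tendsto_inv_atTop_nhdsGT_zero
  simpa [Function.comp_def, div_eq_mul_inv, hn'] using h
end
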